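/- arXiv:2005.13134 — 4 statements merged into one kernel-verified Lean document; each statement's English description precedes it below -/
import Mathlib

section
/- Suppose ρ_1,…,ρ_K > 0 satisfy Σ_{i=1}^K T_{ki} ρ_i = σ² for every k = 1,…,K. Then the matrix T is nonsingular (invertible). -/
open Matrix Finset ComplexOrder

/-- A real matrix with nonpositive off-diagonal entries that sends some positive vector to a
positive vector is nonsingular. -/
theorem isUnit_det_of_offDiag_nonpos_of_pos_mulVec {n : Type*} [Fintype n] [DecidableEq n]
    {A : Matrix n n ℝ} (hA : ∀ k i, k ≠ i → A k i ≤ 0) {v : n → ℝ} (hv : ∀ i, 0 < v i)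
    (hAv : ∀ k, 0 < ∑ i, A k i * v i) : IsUnit A.det := by
  have hdet : (A * diagonal v).det ≠ 0 := by
    refine det_ne_zero_of_sum_row_lt_diag fun k => ?_
    have hoff : ∑ i ∈ univ.erase k, ‖(A * diagonal v) k i‖ =
        -∑ i ∈ univ.erase k, A k i * v i := by
      rw [← Finset.sum_neg_distrib]
      refine Finset.sum_congr rfl fun i hi => ?_
      rw [mul_diagonal, Real.norm_of_nonpos]
      exact mul_nonpos_of_nonpos_of_nonneg (hA k i (Finset.ne_of_mem_erase hi).symm) (hv i).le
    have hsum := hAv k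
    rw [← Finset.add_sum_erase _ _ (Finset.mem_univ k)] at hsum
    rw [hoff, mul_diagonal]
    exact lt_of_lt_of_le (by linarith) (Real.le_norm_self (A k k * v k))
  rw [det_mul] at hdet
  exact isUnit_iff_ne_zero.mpr (left_ne_zero_of_mul hdet)

/-- If `ρ₁,…,ρ_K > 0` satisfy `∑ᵢ T_{k i} ρᵢ = σ²` for every `k`,
then the matrix `T` (defined by `T_{kk} = (1/γ_k) p̲ₖᴴ R_k p̲ₖ` and
`T_{ki} = −p̲ᵢᴴ R_k p̲ᵢ` for `i ≠ k`) is nonsingular. -/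
theorem stmt_0 (M K : ℕ) (hM : 0 < M) (hK : 0 < K)
    (σ : ℝ) (hσ : 0 < σ)
    (R : Fin K → Matrix (Fin M) (Fin M) ℂ) (hR : ∀ k, (R k).PosSemidef)
    (p : Fin K → (Fin M → ℂ)) (hp : ∀ k, star (p k) ⬝ᵥ p k = 1)
    (γ : Fin K → ℝ) (hγ : ∀ k, 0 < γ k)
    (T : Matrix (Fin K) (Fin K) ℝ)
    (hTdiag : ∀ k, T k k = (1 / γ k) * (star (p k) ⬝ᵥ (R k) *ᵥ (p k)).re)
    (hToff : ∀ k i, k ≠ i → T k i = -((star (p i) ⬝ᵥ (R k) *ᵥ (p i)).re))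
    (ρ : Fin K → ℝ) (hρ : ∀ i, 0 < ρ i)
    (heq : ∀ k, ∑ i, T k i * ρ i = σ ^ 2) :
    IsUnit T.det := by
  refine isUnit_det_of_offDiag_nonpos_of_pos_mulVec (fun k i hki => ?_) hρ fun k => ?_
  · rw [hToff k i hki]
    exact neg_nonpos.mpr ((hR k).re_dotProduct_nonneg (p i))
  · rw [heq k]
    positivity
end

section
/- Let γ_1,…,γ_K > 0, and suppose (p_1^⋄,…,p_K^⋄) with every p_k^⋄ ≠ 0 minimizes the total power Σ_{k=1}^K p_k^H p_k over the feasible set F = {(p_1,…,p_K) : for all k, σ² + Σ_{i≠k} p_i^H R_k p_i ≤ (1/γ_k)·p_k^H R_k p_k}. Suppose further that nonnegative reals μ_1,…,μ_K satisfy, for every k, the stationarity condition p_k^⋄ + Σ_{i≠k} (μ_i/σ²) R_i p_k^⋄ − (μ_k/(σ² γ_k)) R_k p_k^⋄ = 0 and the complementary slackness condition μ_k·(σ² + Σ_{i≠k} (p_i^⋄)^H R_k p_i^⋄ − (1/γ_k)(p_k^⋄)^H R_k p_k^⋄) = 0. Then for each k, (γ_k, p_k^⋄) is a generalized eigenpair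 of the pair (S_k, N_k), i.e. S_k p_k^⋄ = γ_k N_k p_k^⋄, and γ_k is the maximum generalized eigenvalue: γ_k ≥ λ for every real λ such that S_k v = λ N_k v for some nonzero v ∈ ℂ^M. -/
open Matrix Finset ComplexOrder

/-- A matrix with nonpositive off-diagonal entries whose columns have positive sums for some
positive weights is monotone. -/
lemma Matrix.nonneg_of_mulVec_nonneg_of_weighted_col_sum_pos {ι : Type*} [Fintype ι]
    {B : Matrix ι ι ℝ} (hB : ∀ i j, i ≠ j → B i j ≤ 0) {w : ι → ℝ} (hw : ∀ i, 0 < w i)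
    (hcol : ∀ j, 0 < ∑ i, w i * B i j) {x : ι → ℝ} (hx : ∀ i, 0 ≤ (B *ᵥ x) i) (i : ι) :
    0 ≤ x i := by
  classical
  by_contra! hi
  set N := Finset.univ.filter fun i => x i < 0
  have hnonneg : 0 ≤ ∑ i ∈ N, w i * (B *ᵥ x) i :=
    Finset.sum_nonneg fun i _ => mul_nonneg (hw i).le (hx i)
  have hswap : ∑ i ∈ N, w i * (B *ᵥ x) i = ∑ j, x j * ∑ i ∈ N, w i * B i j := by
    simp only [Matrix.mulVec, dotProduct, Finset.mul_sum]
    rw [Finset.sum_comm]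
    exact Finset.sum_congr rfl fun j _ => Finset.sum_congr rfl fun i _ => by ring
  have hneg : ∀ j, x j < 0 → x j * ∑ i ∈ N, w i * B i j < 0 := by
    intro j hj
    refine mul_neg_of_neg_of_pos hj ((hcol j).trans_le ?_)
    rw [← Finset.sum_filter_add_sum_filter_not Finset.univ (fun i => x i < 0),
      add_le_iff_nonpos_right]
    refine Finset.sum_nonpos fun i hi => mul_nonpos_of_nonneg_of_nonpos (hw i).le (hB i j ?_)
    rintro rfl
    exact (Finset.mem_filter.1 hi).2 hj
  have hnonpos : ∀ j, x j * ∑ i ∈ N, w i * B i j ≤ 0 := by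
    intro j
    by_cases hj : x j < 0
    · exact (hneg j hj).le
    · refine mul_nonpos_of_nonneg_of_nonpos (not_lt.1 hj) (Finset.sum_nonpos fun i hi =>
        mul_nonpos_of_nonneg_of_nonpos (hw i).le (hB i j ?_))
      rintro rfl
      exact hj (Finset.mem_filter.1 hi).2
  have := Finset.sum_lt_sum (fun j _ => hnonpos j) ⟨i, Finset.mem_univ i, hneg i hi⟩
  rw [Finset.sum_const_zero, ← hswap] at this
  exact absurd hnonneg (not_le.2 this)

/-- Under the hypotheses of `Matrix.nonneg_of_mulVec_nonneg_of_weighted_col_sum_pos`, every linear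
system with nonnegative right-hand side has a nonnegative solution. -/
lemma Matrix.exists_nonneg_mulVec_eq_of_weighted_col_sum_pos {ι : Type*} [Fintype ι]
    {B : Matrix ι ι ℝ} (hB : ∀ i j, i ≠ j → B i j ≤ 0) {w : ι → ℝ} (hw : ∀ i, 0 < w i)
    (hcol : ∀ j, 0 < ∑ i, w i * B i j) {b : ι → ℝ} (hb : ∀ i, 0 ≤ b i) :
    ∃ x : ι → ℝ, (∀ i, 0 ≤ x i) ∧ B *ᵥ x = b := by
  have hmono := fun x hx =>
    Matrix.nonneg_of_mulVec_nonneg_of_weighted_col_sum_pos hB hw hcol (x := x) hx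
  have hinj : Function.Injective B.mulVecLin := by
    rw [injective_iff_map_eq_zero]
    intro x hx
    rw [Matrix.mulVecLin_apply] at hx
    funext i
    refine le_antisymm ?_ (hmono x (fun i => by simp [hx]) i)
    simpa using hmono (-x) (fun i => by simp [Matrix.mulVec_neg, hx]) i
  obtain ⟨x, hx⟩ := LinearMap.injective_iff_surjective.1 hinj b
  rw [Matrix.mulVecLin_apply] at hx
  exact ⟨x, hmono x (fun i => by rw [hx]; exact hb i), hx⟩

/-- If weights `w` are feasible for the dual power-control problem with cost `c`, strictly so in
one coordinate, then the primal problem has a solution of cost below the dual value. -/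
lemma Matrix.exists_nonneg_mulVec_eq_cost_lt {ι : Type*} [Fintype ι]
    {B : Matrix ι ι ℝ} (hB : ∀ i j, i ≠ j → B i j ≤ 0) {w : ι → ℝ} (hw : ∀ i, 0 < w i)
    {c : ι → ℝ} (hc : ∀ j, 0 < c j) (hcol : ∀ j, c j ≤ ∑ i, w i * B i j)
    {j₀ : ι} (hj₀ : c j₀ < ∑ i, w i * B i j₀) {b : ι → ℝ} (hb : ∀ i, 0 < b i) :
    ∃ x : ι → ℝ, (∀ i, 0 ≤ x i) ∧ B *ᵥ x = b ∧ ∑ j, x j * c j < ∑ i, w i * b i := by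
  obtain ⟨x, hx, hBx⟩ := Matrix.exists_nonneg_mulVec_eq_of_weighted_col_sum_pos hB hw
    (fun j => (hc j).trans_le (hcol j)) fun i => (hb i).le
  refine ⟨x, hx, hBx, ?_⟩
  have hpos : 0 < x j₀ := by
    refine (hx j₀).lt_of_ne fun h0 => (hb j₀).not_ge ?_
    rw [← hBx, Matrix.mulVec, dotProduct]
    refine Finset.sum_nonpos fun j _ => ?_
    rcases eq_or_ne j₀ j with rfl | hj
    · simp [← h0]
    · exact mul_nonpos_of_nonpos_of_nonneg (hB _ _ hj) (hx j)
  have hswap : ∑ i, w i * b i = ∑ j, x j * ∑ i, w i * B i j := by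
    simp only [← hBx, Matrix.mulVec, dotProduct, Finset.mul_sum]
    rw [Finset.sum_comm]
    exact Finset.sum_congr rfl fun j _ => Finset.sum_congr rfl fun i _ => by ring
  rw [hswap]
  exact Finset.sum_lt_sum (fun j _ => mul_le_mul_of_nonneg_left (hcol j) (hx j))
    ⟨j₀, Finset.mem_univ _, mul_lt_mul_of_pos_left hj₀ hpos⟩

lemma re_star_dotProduct_self_pos {n : Type*} [Fintype n] {v : n → ℂ} (hv : v ≠ 0) :
    0 < (star v ⬝ᵥ v).re :=
  (Complex.pos_iff.1 (dotProduct_star_self_pos_iff.2 hv)).1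

lemma re_star_smul_dotProduct_smul {n : Type*} [Fintype n] (A : Matrix n n ℂ) {x : ℝ}
    (hx : 0 ≤ x) (v : n → ℂ) :
    (star (((√x : ℝ) : ℂ) • v) ⬝ᵥ A *ᵥ (((√x : ℝ) : ℂ) • v)).re
      = x * (star v ⬝ᵥ A *ᵥ v).re := by
  rw [Matrix.mulVec_smul, star_smul, smul_dotProduct, dotProduct_smul, smul_smul]
  simp only [RCLike.star_def, Complex.conj_ofReal, ← Complex.ofReal_mul, Real.mul_self_sqrt hx,
    smul_eq_mul, Complex.re_ofReal_mul]

lemma re_star_dotProduct_noise_mulVec {n ι : Type*} [Fintype n] [DecidableEq n] (s : Finset ι)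
    (a : ℝ) (μ : ι → ℝ) (R : ι → Matrix n n ℂ) (v : n → ℂ) :
    (star v ⬝ᵥ (((a : ℂ) • (1 : Matrix n n ℂ) + ∑ i ∈ s, ((μ i : ℝ) : ℂ) • R i) *ᵥ v)).re
      = a * (star v ⬝ᵥ v).re + ∑ i ∈ s, μ i * (star v ⬝ᵥ R i *ᵥ v).re := by
  simp only [Matrix.add_mulVec, Matrix.sum_mulVec, Matrix.smul_mulVec, Matrix.one_mulVec,
    dotProduct_add, dotProduct_sum, dotProduct_smul, smul_eq_mul, Complex.add_re, Complex.re_sum,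
    Complex.re_ofReal_mul]

/-- If `(p₁⋄,…,p_K⋄)` (all nonzero) minimizes the total power over the
feasible set `F = {p : ∀ k, σ² + ∑_{i≠k} pᵢᴴ R_k pᵢ ≤ (1/γ_k) p_kᴴ R_k p_k}`, and
nonnegative `μ₁,…,μ_K` satisfy the stationarity and complementary-slackness conditions,
then for each `k`, `(γ_k, p_k⋄)` is a generalized eigenpair of `(S_k, N_k)` and `γ_k`
is the maximum generalized eigenvalue. -/
theorem stmt_2 (M K : ℕ) (hM : 0 < M) (hK : 0 < K)
    (σ : ℝ) (hσ : 0 < σ)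
    (R : Fin K → Matrix (Fin M) (Fin M) ℂ) (hR : ∀ k, (R k).PosSemidef)
    (γ : Fin K → ℝ) (hγ : ∀ k, 0 < γ k)
    (p : Fin K → (Fin M → ℂ)) (hpne : ∀ k, p k ≠ 0)
    (hp_feas : ∀ k, σ ^ 2 + ∑ i ∈ Finset.univ.erase k, (star (p i) ⬝ᵥ (R k) *ᵥ (p i)).re
        ≤ (1 / γ k) * (star (p k) ⬝ᵥ (R k) *ᵥ (p k)).re)
    (hp_min : ∀ q : Fin K → (Fin M → ℂ),
        (∀ k, σ ^ 2 + ∑ i ∈ Finset.univ.erase k, (star (q i) ⬝ᵥ (R k) *ᵥ (q i)).re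
          ≤ (1 / γ k) * (star (q k) ⬝ᵥ (R k) *ᵥ (q k)).re) →
        ∑ k, (star (p k) ⬝ᵥ p k).re ≤ ∑ k, (star (q k) ⬝ᵥ q k).re)
    (μ : Fin K → ℝ) (hμ : ∀ k, 0 ≤ μ k)
    (hstat : ∀ k, p k + (∑ i ∈ Finset.univ.erase k, ((μ i / σ ^ 2 : ℝ) : ℂ) • ((R i) *ᵥ p k))
        - ((μ k / (σ ^ 2 * γ k) : ℝ) : ℂ) • ((R k) *ᵥ p k) = 0)
    (hcs : ∀ k, μ k * (σ ^ 2 + ∑ i ∈ Finset.univ.erase k, (star (p i) ⬝ᵥ (R k) *ᵥ (p i)).re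
        - (1 / γ k) * (star (p k) ⬝ᵥ (R k) *ᵥ (p k)).re) = 0) :
    ∀ k, (((μ k : ℝ) : ℂ) • R k) *ᵥ p k
        = ((γ k : ℝ) : ℂ) • ((((σ ^ 2 : ℝ) : ℂ) • (1 : Matrix (Fin M) (Fin M) ℂ)
            + ∑ i ∈ Finset.univ.erase k, ((μ i : ℝ) : ℂ) • R i) *ᵥ p k)
      ∧ ∀ (lam : ℝ) (v : Fin M → ℂ), v ≠ 0 →
          (((μ k : ℝ) : ℂ) • R k) *ᵥ v
            = ((lam : ℝ) : ℂ) • ((((σ ^ 2 : ℝ) : ℂ) • (1 : Matrix (Fin M) (Fin M) ℂ)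
                + ∑ i ∈ Finset.univ.erase k, ((μ i : ℝ) : ℂ) • R i) *ᵥ v) → lam ≤ γ k := by
  have heig : ∀ k, (((μ k : ℝ) : ℂ) • R k) *ᵥ p k
      = ((γ k : ℝ) : ℂ) • ((((σ ^ 2 : ℝ) : ℂ) • (1 : Matrix (Fin M) (Fin M) ℂ)
          + ∑ i ∈ Finset.univ.erase k, ((μ i : ℝ) : ℂ) • R i) *ᵥ p k) := by
    intro k
    have hσ0 : (σ : ℂ) ≠ 0 := by exact_mod_cast hσ.ne'
    have hγ0 : (γ k : ℂ) ≠ 0 := by exact_mod_cast (hγ k).ne'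
    have h := congrArg (fun v => (((γ k * σ ^ 2 : ℝ)) : ℂ) • v) (hstat k)
    simp only [smul_sub, smul_add, smul_zero, Finset.smul_sum, smul_smul] at h
    simp only [Matrix.add_mulVec, Matrix.sum_mulVec, Matrix.smul_mulVec, Matrix.one_mulVec,
      smul_add, Finset.smul_sum, smul_smul]
    rw [sub_eq_zero] at h
    push_cast at h ⊢
    have h₁ : (γ k : ℂ) * σ ^ 2 * (μ k / (σ ^ 2 * γ k)) = μ k := by field_simp
    have h₂ : ∀ i, (γ k : ℂ) * σ ^ 2 * (μ i / σ ^ 2) = γ k * μ i := fun i => by field_simp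
    simp only [h₁, h₂] at h
    exact h.symm
  intro k
  refine ⟨heig k, fun lam v hv hlam => ?_⟩
  by_contra! hlt
  have hσ2 : 0 < σ ^ 2 := by positivity
  have hR0 : ∀ i u, 0 ≤ (star u ⬝ᵥ R i *ᵥ u).re := fun i u => (hR i).re_dotProduct_nonneg u
  have hquad : ∀ j (t : ℝ) (u : Fin M → ℂ), (((μ j : ℝ) : ℂ) • R j) *ᵥ u
      = ((t : ℝ) : ℂ) • ((((σ ^ 2 : ℝ) : ℂ) • (1 : Matrix (Fin M) (Fin M) ℂ)
          + ∑ i ∈ Finset.univ.erase j, ((μ i : ℝ) : ℂ) • R i) *ᵥ u) →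
      μ j * (star u ⬝ᵥ R j *ᵥ u).re = t * (σ ^ 2 * (star u ⬝ᵥ u).re
        + ∑ i ∈ Finset.univ.erase j, μ i * (star u ⬝ᵥ R i *ᵥ u).re) := by
    intro j t u h
    have h := congrArg (fun w => (star u ⬝ᵥ w).re) h
    simpa only [dotProduct_smul, smul_eq_mul, Complex.re_ofReal_mul, Matrix.smul_mulVec,
      re_star_dotProduct_noise_mulVec] using h
  have hnoise : ∀ j (u : Fin M → ℂ), u ≠ 0 → 0 < σ ^ 2 * (star u ⬝ᵥ u).re
      + ∑ i ∈ Finset.univ.erase j, μ i * (star u ⬝ᵥ R i *ᵥ u).re := fun j u hu =>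
    add_pos_of_pos_of_nonneg (mul_pos hσ2 (re_star_dotProduct_self_pos hu))
      (Finset.sum_nonneg fun i _ => mul_nonneg (hμ i) (hR0 i u))
  have hμ0 : ∀ j, 0 < μ j := by
    intro j
    refine (hμ j).lt_of_ne fun h0 => ?_
    have h := hquad j _ _ (heig j)
    rw [← h0, zero_mul] at h
    exact (mul_pos (hγ j) (hnoise j _ (hpne j))).ne h
  -- The gain matrix of a choice of beam directions.
  let B : (Fin K → Fin M → ℂ) → Matrix (Fin K) (Fin K) ℝ := fun u => Matrix.of fun i j =>
    if i = j then (1 / γ i) * (star (u j) ⬝ᵥ R i *ᵥ u j).re else -(star (u j) ⬝ᵥ R i *ᵥ u j).re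
  have hBcol : ∀ u j, ∑ i, μ i * B u i j = (1 / γ j) * (μ j * (star (u j) ⬝ᵥ R j *ᵥ u j).re)
      - ∑ i ∈ Finset.univ.erase j, μ i * (star (u j) ⬝ᵥ R i *ᵥ u j).re := by
    intro u j
    rw [← Finset.add_sum_erase _ _ (Finset.mem_univ j), sub_eq_add_neg, ← Finset.sum_neg_distrib]
    congr 1
    · simp only [B, Matrix.of_apply, if_true]
      ring
    · refine Finset.sum_congr rfl fun i hi => ?_
      simp only [B, Matrix.of_apply, if_neg (Finset.ne_of_mem_erase hi)]
      ring
  have hBrow : ∀ u (x : Fin K → ℝ) i, (B u *ᵥ x) i =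
      (1 / γ i) * (x i * (star (u i) ⬝ᵥ R i *ᵥ u i).re)
      - ∑ j ∈ Finset.univ.erase i, x j * (star (u j) ⬝ᵥ R i *ᵥ u j).re := by
    intro u x i
    rw [Matrix.mulVec, dotProduct, ← Finset.add_sum_erase _ _ (Finset.mem_univ i), sub_eq_add_neg,
      ← Finset.sum_neg_distrib]
    congr 1
    · simp only [B, Matrix.of_apply, if_true]
      ring
    · refine Finset.sum_congr rfl fun j hj => ?_
      simp only [B, Matrix.of_apply, if_neg (Finset.ne_of_mem_erase hj).symm]
      ring
  have hcolp : ∀ u j, u j = p j → ∑ i, μ i * B u i j = σ ^ 2 * (star (u j) ⬝ᵥ u j).re := by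
    intro u j huj
    rw [hBcol, huj, hquad j _ _ (heig j), ← mul_assoc, one_div_mul_cancel (hγ j).ne']
    ring
  let u := Function.update p k v
  have huk : u k = v := Function.update_self ..
  have huj : ∀ j, j ≠ k → u j = p j := fun j hj => Function.update_of_ne hj ..
  have hune : ∀ j, u j ≠ 0 := by
    intro j
    rcases eq_or_ne j k with rfl | hj
    · rwa [huk]
    · rw [huj j hj]
      exact hpne j
  have hcolk : σ ^ 2 * (star (u k) ⬝ᵥ u k).re < ∑ i, μ i * B u i k := by
    rw [hBcol, huk, hquad k _ _ hlam, ← mul_assoc, lt_sub_iff_add_lt]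
    refine lt_mul_of_one_lt_left (hnoise k v hv) ?_
    rwa [one_div, inv_mul_eq_div, one_lt_div (hγ k)]
  obtain ⟨x, hx, hBx, hcost⟩ := Matrix.exists_nonneg_mulVec_eq_cost_lt (B := B u)
    (fun i j hij => by simpa only [B, Matrix.of_apply, if_neg hij, neg_nonpos] using hR0 i (u j))
    hμ0 (c := fun j => σ ^ 2 * (star (u j) ⬝ᵥ u j).re)
    (fun j => mul_pos hσ2 (re_star_dotProduct_self_pos (hune j)))
    (fun j => by
      rcases eq_or_ne j k with rfl | hj
      · exact hcolk.le
      · exact (hcolp u j (huj j hj)).ge)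
    hcolk (b := fun _ => σ ^ 2) (fun _ => hσ2)
  have hpow : ∑ j, σ ^ 2 * (star (p j) ⬝ᵥ p j).re = ∑ i, μ i * σ ^ 2 := by
    have hrow : ∀ i, (B p *ᵥ fun _ => 1) i = σ ^ 2 := by
      intro i
      have h := (mul_eq_zero.1 (hcs i)).resolve_left (hμ0 i).ne'
      rw [hBrow]
      simp only [one_mul]
      linarith
    calc ∑ j, σ ^ 2 * (star (p j) ⬝ᵥ p j).re = ∑ j, ∑ i, μ i * B p i j :=
          Finset.sum_congr rfl fun j _ => (hcolp p j rfl).symm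
      _ = ∑ i, μ i * (B p *ᵥ fun _ => 1) i := by
          simp only [Matrix.mulVec, dotProduct, mul_one, Finset.mul_sum]
          exact Finset.sum_comm
      _ = ∑ i, μ i * σ ^ 2 := by simp only [hrow]
  have hmin := hp_min (fun j => ((√(x j) : ℝ) : ℂ) • u j) fun i => by
    simp only [re_star_smul_dotProduct_smul _ (hx _)]
    have h := congrFun hBx i
    rw [hBrow] at h
    linarith
  have hnorm : ∀ j, (star (((√(x j) : ℝ) : ℂ) • u j) ⬝ᵥ (((√(x j) : ℝ) : ℂ) • u j)).re
      = x j * (star (u j) ⬝ᵥ u j).re := fun j => by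
    simpa only [Matrix.one_mulVec] using re_star_smul_dotProduct_smul 1 (hx j) (u j)
  simp only [hnorm] at hmin
  simp only [mul_left_comm _ (σ ^ 2)] at hcost
  rw [← hpow, ← Finset.mul_sum, ← Finset.mul_sum] at hcost
  exact (lt_of_mul_lt_mul_left hcost hσ2.le).not_ge hmin
end

section
/- Let μ_1,…,μ_K ≥ 0. Suppose for each k there are a real λ_k > 0 and a unit vector p̲_k ∈ ℂ^M with μ_k R_k p̲_k = λ_k (σ² I + Σ_{i≠k} μ_i R_i) p̲_k, and positive reals ρ_1,…,ρ_K satisfying, for every k, σ² + Σ_{i≠k} ρ_i·(p̲_i^H R_k p̲_i) = (ρ_k/λ_k)·(p̲_k^H R_k p̲_k). Then Σ_{k=1}^K μ_k = Σ_{k=1}^K ρ_k. -/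
open Matrix Finset ComplexOrder

/-- Uplink-downlink power duality for a real coupling matrix `A`: if both SINR systems hold with
the same targets `lam`, the total powers agree. -/
theorem sum_eq_sum_of_dual_power_balance {ι : Type*} [Fintype ι] [DecidableEq ι]
    {s : ℝ} (hs : s ≠ 0) (A : ι → ι → ℝ) (μ ρ lam : ι → ℝ) (hlam : ∀ k, lam k ≠ 0)
    (hμ : ∀ k, μ k * A k k = lam k * (s + ∑ i ∈ Finset.univ.erase k, μ i * A k i))
    (hρ : ∀ k, s + ∑ i ∈ Finset.univ.erase k, ρ i * A i k = ρ k / lam k * A k k) :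
    ∑ k, μ k = ∑ k, ρ k := by
  have hk (k : ι) : s * μ k + ∑ i, μ k * ρ i * A i k = s * ρ k + ∑ i, ρ k * μ i * A k i := by
    have hdual : μ k * (s + ∑ i ∈ Finset.univ.erase k, ρ i * A i k)
        = ρ k * (s + ∑ i ∈ Finset.univ.erase k, μ i * A k i) := by
      have hlamk := hlam k
      rw [hρ k]
      calc μ k * (ρ k / lam k * A k k) = ρ k / lam k * (μ k * A k k) := by ring
        _ = _ := by rw [hμ k]; field_simp
    simp only [mul_assoc, ← Finset.mul_sum]
    rw [← Finset.add_sum_erase _ _ (Finset.mem_univ k),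
      ← Finset.add_sum_erase _ (fun i => μ i * A k i) (Finset.mem_univ k)]
    linear_combination hdual
  have hsum := Finset.sum_congr rfl fun k (_ : k ∈ Finset.univ) => hk k
  have hswap : ∑ k, ∑ i, μ k * ρ i * A i k = ∑ k, ∑ i, ρ k * μ i * A k i := by
    rw [Finset.sum_comm]
    simp only [mul_comm (μ _)]
  rw [Finset.sum_add_distrib, Finset.sum_add_distrib, hswap, ← Finset.mul_sum,
    ← Finset.mul_sum] at hsum
  exact mul_left_cancel₀ hs (add_right_cancel hsum)

/-- If `μ₁,…,μ_K ≥ 0`, and for each `k` there are `λ_k > 0` and a unit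
vector `p̲_k` with `μ_k R_k p̲_k = λ_k (σ² I + ∑_{i≠k} μ_i R_i) p̲_k`, and positive
`ρ₁,…,ρ_K` satisfy `σ² + ∑_{i≠k} ρ_i p̲ᵢᴴ R_k p̲ᵢ = (ρ_k/λ_k) p̲_kᴴ R_k p̲_k` for
all `k`, then `∑ μ_k = ∑ ρ_k`. -/
theorem stmt_3 (M K : ℕ) (hM : 0 < M) (hK : 0 < K)
    (σ : ℝ) (hσ : 0 < σ)
    (R : Fin K → Matrix (Fin M) (Fin M) ℂ) (hR : ∀ k, (R k).PosSemidef)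
    (μ : Fin K → ℝ) (hμ : ∀ k, 0 ≤ μ k)
    (lam : Fin K → ℝ) (hlam : ∀ k, 0 < lam k)
    (p : Fin K → (Fin M → ℂ)) (hp : ∀ k, star (p k) ⬝ᵥ p k = 1)
    (heig : ∀ k, (((μ k : ℝ) : ℂ) • R k) *ᵥ p k
        = ((lam k : ℝ) : ℂ) • ((((σ ^ 2 : ℝ) : ℂ) • (1 : Matrix (Fin M) (Fin M) ℂ)
            + ∑ i ∈ Finset.univ.erase k, ((μ i : ℝ) : ℂ) • R i) *ᵥ p k))
    (ρ : Fin K → ℝ) (hρ : ∀ k, 0 < ρ k)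
    (hpow : ∀ k, σ ^ 2 + ∑ i ∈ Finset.univ.erase k, ρ i * (star (p i) ⬝ᵥ (R k) *ᵥ (p i)).re
        = (ρ k / lam k) * (star (p k) ⬝ᵥ (R k) *ᵥ (p k)).re) :
    ∑ k, μ k = ∑ k, ρ k := by
  refine sum_eq_sum_of_dual_power_balance (pow_pos hσ 2).ne'
    (fun i k => (star (p i) ⬝ᵥ (R k) *ᵥ (p i)).re) μ ρ lam (fun k => (hlam k).ne') ?_ hpow
  intro k
  have h := congrArg (fun v => (star (p k) ⬝ᵥ v).re) (heig k)
  simpa only [Matrix.add_mulVec, Matrix.sum_mulVec, Matrix.smul_mulVec, Matrix.one_mulVec,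
    dotProduct_smul, dotProduct_add, dotProduct_sum, smul_eq_mul, Complex.re_ofReal_mul,
    Complex.add_re, Complex.re_sum, hp, Complex.ofReal_re, Complex.one_re, mul_one] using h
end

section
/- Let μ_1,…,μ_K ≥ 0, let h̄_1,…,h̄_K ∈ ℂ^M, fix k, and let B = σ² I + Σ_{i=1}^K μ_i h̄_i h̄_i^H, which is Hermitian positive definite and hence invertible. Suppose γ > 0 and p ∈ ℂ^M satisfy μ_k h̄_k h̄_k^H p = γ (σ² I + Σ_{i≠k} μ_i h̄_i h̄_i^H) p. Then p = (1 + 1/γ)·μ_k·(h̄_k^H p)·B^{-1} h̄_k. -/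
open Matrix Finset ComplexOrder

/-- With `B = σ² I + ∑ᵢ μᵢ h̄ᵢ h̄ᵢᴴ` (Hermitian positive definite,
hence invertible), if `γ > 0` and `μ_k h̄_k h̄_kᴴ p = γ (σ² I + ∑_{i≠k} μᵢ h̄ᵢ h̄ᵢᴴ) p`,
then `p = (1 + 1/γ) μ_k (h̄_kᴴ p) B⁻¹ h̄_k`. -/
theorem stmt_7 (M K : ℕ) (hM : 0 < M) (hK : 0 < K)
    (σ : ℝ) (hσ : 0 < σ)
    (μ : Fin K → ℝ) (hμ : ∀ k, 0 ≤ μ k)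
    (hbar : Fin K → (Fin M → ℂ))
    (k : Fin K)
    (B : Matrix (Fin M) (Fin M) ℂ)
    (hB : B = ((σ ^ 2 : ℝ) : ℂ) • (1 : Matrix (Fin M) (Fin M) ℂ)
        + ∑ i, ((μ i : ℝ) : ℂ) • vecMulVec (hbar i) (star (hbar i)))
    (γ : ℝ) (hγ : 0 < γ)
    (p : Fin M → ℂ)
    (heig : (((μ k : ℝ) : ℂ) • vecMulVec (hbar k) (star (hbar k))) *ᵥ p
        = ((γ : ℝ) : ℂ) • ((((σ ^ 2 : ℝ) : ℂ) • (1 : Matrix (Fin M) (Fin M) ℂ)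
            + ∑ i ∈ Finset.univ.erase k, ((μ i : ℝ) : ℂ) • vecMulVec (hbar i) (star (hbar i))) *ᵥ p)) :
    B.PosDef ∧ IsUnit B.det ∧
      p = ((((1 + 1 / γ) * μ k : ℝ) : ℂ) * (star (hbar k) ⬝ᵥ p)) • (B⁻¹ *ᵥ hbar k) := by
  have hpos : B.PosDef := by
    rw [hB]
    refine (PosDef.one.smul (Complex.zero_lt_real.mpr (by positivity))).add_posSemidef
      (posSemidef_sum _ fun i _ => ?_)
    exact (posSemidef_vecMulVec_self_star (hbar i)).smul (Complex.zero_le_real.mpr (hμ i))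
  have hdet : IsUnit B.det := (isUnit_iff_isUnit_det B).mp hpos.isUnit
  refine ⟨hpos, hdet, ?_⟩
  set R := ((μ k : ℝ) : ℂ) • vecMulVec (hbar k) (star (hbar k)) with hR
  set C := ((σ ^ 2 : ℝ) : ℂ) • (1 : Matrix (Fin M) (Fin M) ℂ)
    + ∑ i ∈ Finset.univ.erase k, ((μ i : ℝ) : ℂ) • vecMulVec (hbar i) (star (hbar i)) with hC
  have hBRC : B = R + C := by
    rw [hB, ← Finset.add_sum_erase _ _ (Finset.mem_univ k), hR, hC]
    abel
  have hγ' : (γ : ℂ) ≠ 0 := Complex.ofReal_ne_zero.mpr hγ.ne'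
  have hCp : C *ᵥ p = (γ : ℂ)⁻¹ • R *ᵥ p := by
    rw [heig, smul_smul, inv_mul_cancel₀ hγ', one_smul]
  have hRp : R *ᵥ p = ((μ k : ℂ) * (star (hbar k) ⬝ᵥ p)) • hbar k := by
    rw [hR, smul_mulVec, vecMulVec_mulVec, op_smul_eq_smul, smul_smul]
  have hBp : B *ᵥ p = ((((1 + 1 / γ) * μ k : ℝ) : ℂ) * (star (hbar k) ⬝ᵥ p)) • hbar k := by
    rw [hBRC, add_mulVec, hCp, hRp, smul_smul, ← add_smul]
    congr 1
    push_cast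
    ring
  rw [← mulVec_smul, ← hBp, mulVec_mulVec, nonsing_inv_mul _ hdet, one_mulVec]
end
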